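/- arXiv:2408.06517 — 4 statements merged into one kernel-verified Lean document; each statement's English description precedes it below -/
import Mathlib

section
/- Under consistency, randomization, sequential ignorability and positivity, if in addition there exist real constants α, β, γ such that E[T_obs | A = 1, B_obs = u] = α + β·u + γ for every u ∈ S (with S ⊂ ℝ), then the natural indirect effect satisfies E[T(1, B(1)) − T(1, B(0))] = β · ( E[B_obs | A = 1] − E[B_obs | A = 0] ); i.e., the natural indirect effect equals the product β·ζ, where ζ = E[B_obs | A = 1] − E[B_obs | A = 0]. -/
open MeasureTheory ProbabilityTheory

lemma setIntegral_of_indep {Ω E : Type*} [MeasurableSpace Ω] [MeasurableSpace E]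
    (μ : Measure Ω) [IsProbabilityMeasure μ] (X : Ω → ℝ) (Y : Ω → E)
    (hX : Measurable X) (hY : Measurable Y) (h : IndepFun X Y μ) (s : Set E)
    (hs : MeasurableSet s) :
    ∫ ω in Y ⁻¹' s, X ω ∂μ = (μ (Y ⁻¹' s)).toReal * ∫ ω, X ω ∂μ := by
  have hm : Measurable (s.indicator (fun _ => (1 : ℝ))) := measurable_const.indicator hs
  have h2 : IndepFun X (s.indicator (fun _ => (1 : ℝ)) ∘ Y) μ :=
    h.comp (φ := id) measurable_id hm
  have h3 := h2.integral_mul_eq_mul_integral hX.aestronglyMeasurable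
    (hm.comp hY).aestronglyMeasurable
  have h4 : (s.indicator (fun _ => (1 : ℝ)) ∘ Y) = (Y ⁻¹' s).indicator (fun _ => (1 : ℝ)) := by
    ext ω; simp only [Set.indicator, Function.comp, Set.mem_preimage]; rfl
  have h5 : X * (Y ⁻¹' s).indicator (fun _ => (1 : ℝ)) = (Y ⁻¹' s).indicator X := by
    ext ω; simp [Set.indicator]
  rw [h4, h5, integral_indicator (hY hs), integral_indicator (hY hs)] at h3
  rw [h3]
  simp [Measure.real, mul_comm]

lemma indep_of_cond {Ω : Type*} [MeasurableSpace Ω]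
    (μ : Measure Ω) [IsProbabilityMeasure μ] (X Y : Ω → ℝ) (A : Ω → Bool) (a : Bool)
    (hA : Measurable A)
    (hr : IndepFun (fun ω => (X ω, Y ω)) A μ)
    (hc : IndepFun X Y (μ[|{ω | A ω = a}]))
    (hpos : 0 < μ {ω | A ω = a}) : IndepFun X Y μ := by
  have hAm : MeasurableSet {ω | A ω = a} := hA (measurableSet_singleton a)
  have key : ∀ s : Set (ℝ × ℝ), MeasurableSet s →
      μ[|{ω | A ω = a}] ((fun ω => (X ω, Y ω)) ⁻¹' s) = μ ((fun ω => (X ω, Y ω)) ⁻¹' s) := by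
    intro s hs
    have h1 := hr.measure_inter_preimage_eq_mul s {a} hs (measurableSet_singleton a)
    have e : A ⁻¹' {a} = {ω | A ω = a} := rfl
    rw [e] at h1
    rw [cond_apply hAm, Set.inter_comm, h1, mul_comm (μ _) (μ {ω | A ω = a}), ← mul_assoc,
      ENNReal.inv_mul_cancel hpos.ne' (measure_ne_top _ _), one_mul]
  rw [indepFun_iff_measure_inter_preimage_eq_mul] at hc ⊢
  intro s t hs ht
  have h1 := hc s t hs ht
  have k1 := key (s ×ˢ t) (hs.prod ht)
  have k2 := key (s ×ˢ Set.univ) (hs.prod MeasurableSet.univ)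
  have k3 := key (Set.univ ×ˢ t) (MeasurableSet.univ.prod ht)
  have e1 : (fun ω => (X ω, Y ω)) ⁻¹' (s ×ˢ t) = X ⁻¹' s ∩ Y ⁻¹' t := by ext; simp
  have e2 : (fun ω => (X ω, Y ω)) ⁻¹' (s ×ˢ Set.univ) = X ⁻¹' s := by ext; simp
  have e3 : (fun ω => (X ω, Y ω)) ⁻¹' (Set.univ ×ˢ t) = Y ⁻¹' t := by ext; simp
  rw [e1] at k1; rw [e2] at k2; rw [e3] at k3
  rw [← k1, ← k2, ← k3, h1]

/-- Under consistency, randomization, sequential ignorability and positivity, if in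
addition `E[T_obs | A = 1, B_obs = u] = α + β·u + γ` for every `u ∈ S ⊂ ℝ`, then the
natural indirect effect satisfies
`E[T(1,B(1)) − T(1,B(0))] = β · (E[B_obs | A = 1] − E[B_obs | A = 0])`. -/
theorem natural_indirect_effect_product_form
    {Ω : Type*} [MeasurableSpace Ω] (μ : Measure Ω) [IsProbabilityMeasure μ]
    (S : Finset ℝ) (hS : S.Nonempty)
    (A : Ω → Bool) (hA : Measurable A)
    (B : Bool → Ω → ℝ) (hBmeas : ∀ a, Measurable (B a)) (hBS : ∀ a ω, B a ω ∈ S)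
    (T : Bool → ℝ → Ω → ℝ)
    (hTmeas : ∀ a b, Measurable (T a b))
    (hTint : ∀ (a : Bool), ∀ b ∈ S, Integrable (T a b) μ)
    (hrand : ∀ a a' : Bool, ∀ b ∈ S,
      IndepFun (fun ω => (T a' b ω, B a ω)) A μ)
    (hseq : ∀ a a' : Bool, ∀ b ∈ S,
      IndepFun (T a' b) (B a) (μ[|{ω | A ω = a}]))
    (hposA : ∀ a : Bool, 0 < μ {ω | A ω = a})
    (hposB : ∀ a : Bool, ∀ u ∈ S, 0 < μ {ω | B a ω = u})
    (α β γ : ℝ)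
    (hlin : ∀ u ∈ S,
      (∫ ω in {ω | A ω = true} ∩ {ω | B (A ω) ω = u},
          T (A ω) (B (A ω) ω) ω ∂μ)
          / (μ ({ω | A ω = true} ∩ {ω | B (A ω) ω = u})).toReal
        = α + β * u + γ) :
    ∫ ω, (T true (B true ω) ω - T true (B false ω) ω) ∂μ
      = β * ((∫ ω in {ω | A ω = true}, B (A ω) ω ∂μ)
                / (μ {ω | A ω = true}).toReal
              - (∫ ω in {ω | A ω = false}, B (A ω) ω ∂μ)
                / (μ {ω | A ω = false}).toReal) := by
  have hBu : ∀ a u, MeasurableSet {ω | B a ω = u} :=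
    fun a u => hBmeas a (measurableSet_singleton u)
  have hAa : ∀ a, MeasurableSet {ω | A ω = a} := fun a => hA (measurableSet_singleton a)
  have hind : ∀ a, ∀ u ∈ S, IndepFun (T true u) (B a) μ := fun a u hu =>
    indep_of_cond μ _ _ A a hA (hrand a true u hu) (hseq a true u hu)
      (hposA a)
  have hfib : ∀ a, ∀ u ∈ S, ∫ ω in {ω | B a ω = u}, T true u ω ∂μ
      = (μ {ω | B a ω = u}).toReal * ∫ ω, T true u ω ∂μ := fun a u hu =>
    setIntegral_of_indep μ _ _ (hTmeas _ _) (hBmeas a) (hind a u hu) {u}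
      (measurableSet_singleton u)
  have hpA : ∀ a, (μ {ω | A ω = a}).toReal ≠ 0 := fun a =>
    (ENNReal.toReal_pos (hposA a).ne' (measure_ne_top _ _)).ne'
  have hpB : ∀ a, ∀ u ∈ S, (μ {ω | B a ω = u}).toReal ≠ 0 := fun a u hu =>
    (ENNReal.toReal_pos (hposB a u hu).ne' (measure_ne_top _ _)).ne'
  -- mean of the potential outcome
  have hmean : ∀ u ∈ S, ∫ ω, T true u ω ∂μ = α + β * u + γ := by
    intro u hu
    rw [← hlin u hu]
    have es : {ω | A ω = true} ∩ {ω | B (A ω) ω = u}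
        = {ω | A ω = true} ∩ {ω | B true ω = u} := by
      ext ω
      simp only [Set.mem_inter_iff, Set.mem_ofPred_eq]
      constructor
      · rintro ⟨h, h'⟩; rw [h] at h'; exact ⟨h, h'⟩
      · rintro ⟨h, h'⟩; rw [h]; exact ⟨rfl, h'⟩
    have hms : MeasurableSet ({ω | A ω = true} ∩ {ω | B true ω = u}) :=
      (hAa _).inter (hBu _ _)
    have e1 : ∫ ω in {ω | A ω = true} ∩ {ω | B true ω = u}, T (A ω) (B (A ω) ω) ω ∂μ
        = ∫ ω in {ω | A ω = true} ∩ {ω | B true ω = u}, T true u ω ∂μ := by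
      apply setIntegral_congr_fun hms
      rintro ω ⟨h, h'⟩
      simp only [Set.mem_ofPred_eq] at h h'
      simp only [h, h']
    have e2 : ∫ ω in {ω | A ω = true} ∩ {ω | B true ω = u}, T true u ω ∂μ
        = (μ {ω | A ω = true}).toReal * ∫ ω in {ω | B true ω = u}, T true u ω ∂μ := by
      have hg : Measurable (fun p : ℝ × ℝ => ({u} : Set ℝ).indicator (fun _ => p.1) p.2) := by
        have : (fun p : ℝ × ℝ => ({u} : Set ℝ).indicator (fun _ => p.1) p.2)
            = (Prod.snd ⁻¹' ({u} : Set ℝ)).indicator Prod.fst := by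
          ext p; simp [Set.indicator]
        rw [this]
        exact measurable_fst.indicator (measurable_snd (measurableSet_singleton u))
      have hi := (hrand true true u hu).comp (ψ := id) hg measurable_id
      have h := setIntegral_of_indep μ _ _
        (hg.comp ((hTmeas true u).prodMk (hBmeas true))) hA hi {true}
        (measurableSet_singleton _)
      have e : ((fun p : ℝ × ℝ => ({u} : Set ℝ).indicator (fun _ => p.1) p.2) ∘
          fun ω => (T true u ω, B true ω)) = {ω | B true ω = u}.indicator (T true u) := by
        ext ω; simp [Set.indicator]
      rw [e, setIntegral_indicator (hBu _ _), integral_indicator (hBu _ _)] at h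
      exact h
    have e3 : (μ ({ω | A ω = true} ∩ {ω | B true ω = u})).toReal
        = (μ {ω | A ω = true}).toReal * (μ {ω | B true ω = u}).toReal := by
      have hi : IndepFun (B true) A μ :=
        (hrand true true u hu).comp (φ := Prod.snd) (ψ := id) measurable_snd measurable_id
      have h := hi.measure_inter_preimage_eq_mul {u} {true} (measurableSet_singleton _)
        (measurableSet_singleton _)
      rw [← ENNReal.toReal_mul, mul_comm, Set.inter_comm]
      exact congrArg ENNReal.toReal h
    rw [es, e1, e2, e3, hfib true u hu]
    have := hpA true
    have := hpB true u hu
    field_simp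
  have hTsum : ∀ a ω, T true (B a ω) ω
      = ∑ u ∈ S, {ω | B a ω = u}.indicator (T true u) ω := by
    intro a ω
    rw [Finset.sum_eq_single (B a ω)]
    · simp
    · intro b _ hb
      have hn : ω ∉ {ω | B a ω = b} := fun h => hb (Eq.symm h)
      exact Set.indicator_of_notMem hn _
    · intro h; exact absurd (hBS a ω) h
  have hLsum : ∀ a ω, α + β * B a ω + γ
      = ∑ u ∈ S, {ω | B a ω = u}.indicator (fun _ => α + β * u + γ) ω := by
    intro a ω
    rw [Finset.sum_eq_single (B a ω)]
    · simp
    · intro b _ hb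
      have hn : ω ∉ {ω | B a ω = b} := fun h => hb (Eq.symm h)
      exact Set.indicator_of_notMem hn _
    · intro h; exact absurd (hBS a ω) h
  have hTI : ∀ a, Integrable (fun ω => T true (B a ω) ω) μ := by
    intro a
    simp_rw [hTsum a]
    exact integrable_finsetSum _ fun u hu => (hTint true u hu).indicator (hBu a u)
  have hBI : ∀ a, Integrable (B a) μ := by
    intro a
    obtain ⟨C, hC⟩ := S.finite_toSet.isBounded.exists_norm_le
    exact Integrable.of_bound (hBmeas a).aestronglyMeasurable C
      (Filter.Eventually.of_forall fun ω => hC _ (hBS a ω))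
  have hTE : ∀ a, ∫ ω, T true (B a ω) ω ∂μ = α + β * (∫ ω, B a ω ∂μ) + γ := by
    intro a
    have h1 : ∫ ω, T true (B a ω) ω ∂μ = ∫ ω, (α + β * B a ω + γ) ∂μ := by
      simp_rw [hTsum a, hLsum a]
      rw [integral_finsetSum _ fun u hu => (hTint true u hu).indicator (hBu a u),
        integral_finsetSum _ fun u hu => (integrable_const _).indicator (hBu a u)]
      refine Finset.sum_congr rfl fun u hu => ?_
      rw [integral_indicator (hBu a u), integral_indicator (hBu a u), hfib a u hu, hmean u hu]
      simp [Measure.real]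
    have hI : Integrable (fun ω => α + β * B a ω) μ :=
      (integrable_const _).add ((hBI a).const_mul β)
    rw [h1, integral_add hI (integrable_const _),
      integral_add (integrable_const _) ((hBI a).const_mul β), integral_const_mul]
    simp
  have hBE : ∀ a, (∫ ω in {ω | A ω = a}, B (A ω) ω ∂μ) / (μ {ω | A ω = a}).toReal
      = ∫ ω, B a ω ∂μ := by
    intro a
    obtain ⟨u, hu⟩ := hS
    have hi : IndepFun (B a) A μ :=
      (hrand a true u hu).comp (φ := Prod.snd) (ψ := id) measurable_snd measurable_id
    have h := setIntegral_of_indep μ _ _ (hBmeas a) hA hi {a} (measurableSet_singleton _)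
    have e : ∫ ω in {ω | A ω = a}, B (A ω) ω ∂μ = ∫ ω in {ω | A ω = a}, B a ω ∂μ := by
      apply setIntegral_congr_fun (hAa a)
      intro ω h
      simp only [Set.mem_ofPred_eq] at h
      simp only [h]
    rw [e, div_eq_iff (hpA a), mul_comm]
    exact h
  rw [integral_sub (hTI true) (hTI false), hTE, hTE, hBE, hBE]
  ring
end

section
/- The synthetic response has the same conditional mean as the survival time given the covariates: E[Ỹ | σ(Z)] = E[T | σ(Z)] P-almost surely, where Ỹ = 1(T ≤ C)·T / G(T) and σ(Z) is the σ-algebra generated by Z. (In particular, taking trivial Z, E[Ỹ] = E[T].) -/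
open MeasureTheory ProbabilityTheory

/-- The synthetic response `Ỹ = 1(T ≤ C)·T/G(T)` has the same conditional mean as the
survival time given the covariates: `E[Ỹ | σ(Z)] = E[T | σ(Z)]` P-a.s.; in particular
`E[Ỹ] = E[T]`. -/
theorem synthetic_response_same_conditional_mean
    {Ω : Type*} [MeasurableSpace Ω] (μ : Measure Ω) [IsProbabilityMeasure μ]
    {E : Type*} [mE : MeasurableSpace E]
    (T C : Ω → ℝ) (Z : Ω → E)
    (hT : Measurable T) (hC : Measurable C) (hZ : Measurable Z)
    -- independent censoring: C ⫫ (T, Z)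
    (hind : IndepFun C (fun ω => (T ω, Z ω)) μ)
    (G : ℝ → ℝ) (hG : ∀ t, G t = (μ {ω | t ≤ C ω}).toReal)
    (Ytil : Ω → ℝ)
    (hY : ∀ ω, Ytil ω = if T ω ≤ C ω then T ω / G (T ω) else 0)
    (hTint : Integrable T μ)
    (hGpos : ∀ᵐ ω ∂μ, 0 < G (T ω))
    (hint : Integrable (fun ω => |T ω| / G (T ω)) μ) :
    μ[Ytil | MeasurableSpace.comap Z mE] =ᵐ[μ] μ[T | MeasurableSpace.comap Z mE]
    ∧ ∫ ω, Ytil ω ∂μ = ∫ ω, T ω ∂μ := by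
  have hGanti : Antitone G := by
    intro a b hab
    rw [hG, hG]
    apply ENNReal.toReal_mono (measure_ne_top _ _)
    exact measure_mono (fun ω (h : b ≤ C ω) => (hab.trans h : a ≤ C ω))
  have hGm : Measurable G := hGanti.measurable
  have hG0 : ∀ t, 0 ≤ G t := fun t => by rw [hG]; exact ENNReal.toReal_nonneg
  have hYm : Measurable Ytil := by
    have : Ytil = fun ω => if T ω ≤ C ω then T ω / G (T ω) else 0 := funext hY
    rw [this]
    exact Measurable.ite (measurableSet_le hT hC) (hT.div (hGm.comp hT)) measurable_const
  have hYint : Integrable Ytil μ := by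
    refine hint.mono' hYm.aestronglyMeasurable (Filter.Eventually.of_forall fun ω => ?_)
    rw [hY]
    split_ifs with h
    · rw [Real.norm_eq_abs, abs_div, abs_of_nonneg (hG0 _)]
    · simpa using div_nonneg (abs_nonneg (T ω)) (hG0 (T ω))
  have hWm : Measurable (fun ω => (T ω, Z ω)) := hT.prodMk hZ
  have key : ∀ B : Set E, MeasurableSet B →
      ∫ ω in Z ⁻¹' B, Ytil ω ∂μ = ∫ ω in Z ⁻¹' B, T ω ∂μ := by
    intro B hB
    let f : (ℝ × E) × ℝ → ℝ := fun p =>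
      (Prod.snd ⁻¹' B : Set (ℝ × E)).indicator
        (fun w => if w.1 ≤ p.2 then w.1 / G w.1 else 0) p.1
    have hfm : Measurable f := by
      have h1 : Measurable (fun p : (ℝ × E) × ℝ =>
          if p.1.1 ≤ p.2 then p.1.1 / G p.1.1 else 0) :=
        Measurable.ite (measurableSet_le (by fun_prop) (by fun_prop))
          ((by fun_prop : Measurable (fun p : (ℝ × E) × ℝ => p.1.1)).div
            (hGm.comp (by fun_prop))) measurable_const
      exact h1.indicator
        (s := (fun p : (ℝ × E) × ℝ => p.1.2) ⁻¹' B)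
        ((by fun_prop : Measurable (fun p : (ℝ × E) × ℝ => p.1.2)) hB)
    have hpm : Measurable (fun ω => ((T ω, Z ω), C ω)) := hWm.prodMk hC
    have hmap : μ.map (fun ω => ((T ω, Z ω), C ω))
        = (μ.map (fun ω => (T ω, Z ω))).prod (μ.map C) :=
      (indepFun_iff_map_prod_eq_prod_map_map hWm.aemeasurable hC.aemeasurable).1 hind.symm
    have hfY : (fun ω => f ((T ω, Z ω), C ω)) = (Z ⁻¹' B).indicator Ytil := by
      funext ω
      by_cases h : Z ω ∈ B <;> simp [f, h, hY]
    haveI : IsProbabilityMeasure (μ.map C) := Measure.isProbabilityMeasure_map hC.aemeasurable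
    haveI : IsProbabilityMeasure (μ.map (fun ω => (T ω, Z ω))) :=
      Measure.isProbabilityMeasure_map hWm.aemeasurable
    have hfi : Integrable f ((μ.map (fun ω => (T ω, Z ω))).prod (μ.map C)) := by
      rw [← hmap, integrable_map_measure hfm.aestronglyMeasurable hpm.aemeasurable]
      change Integrable (fun ω => f ((T ω, Z ω), C ω)) μ
      rw [hfY]
      exact hYint.indicator (hZ hB)
    have hinner : ∀ w : ℝ × E, ∫ c, f (w, c) ∂(μ.map C)
        = (Prod.snd ⁻¹' B : Set (ℝ × E)).indicator (fun w => w.1 / G w.1 * G w.1) w := by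
      intro w
      by_cases h : w.2 ∈ B
      · have e : (fun c => f (w, c)) = (Set.Ici w.1).indicator (fun _ => w.1 / G w.1) := by
          funext c
          simp [f, h, Set.indicator_apply]
        rw [e, integral_indicator measurableSet_Ici, setIntegral_const, Measure.real,
          Measure.map_apply hC measurableSet_Ici]
        have : G w.1 = (μ (C ⁻¹' Set.Ici w.1)).toReal := hG _
        rw [← this]
        simp [h, mul_comm]
      · simp [f, h]
    rw [← integral_indicator (hZ hB), ← integral_indicator (hZ hB), ← hfY,
      ← integral_map (φ := fun ω => ((T ω, Z ω), C ω)) hpm.aemeasurable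
        hfm.aestronglyMeasurable, hmap, integral_prod _ hfi]
    simp_rw [hinner]
    rw [integral_map hWm.aemeasurable]
    · apply integral_congr_ae
      filter_upwards [hGpos] with ω hω
      by_cases h : Z ω ∈ B
      · simp [h, hω.ne']
      · simp [h]
    · exact (((measurable_fst.div (hGm.comp measurable_fst)).mul
        (hGm.comp measurable_fst)).indicator (measurable_snd hB)).aestronglyMeasurable
  have hm := hZ.comap_le
  refine ⟨?_, by simpa using key Set.univ MeasurableSet.univ⟩
  symm
  refine ae_eq_condExp_of_forall_setIntegral_eq hm hYint
    (fun s _ _ => integrable_condExp.integrableOn) ?_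
    stronglyMeasurable_condExp.aestronglyMeasurable
  rintro s ⟨B, hB, rfl⟩ _
  rw [setIntegral_condExp hm hTint ⟨B, hB, rfl⟩, key B hB]
end

section
/- For every s ∈ ℝ and every event D ∈ σ(Z), E[ T · 1_D · 1(X ≥ s) ] = G(s) · E[ Ỹ · 1_D · 1(X ≥ s) ]. Consequently, whenever P(D ∩ {X ≥ s}) > 0 and G(s) is finite and positive, E[T | D ∩ {X ≥ s}] = G(s) · E[Ỹ | D ∩ {X ≥ s}], where E[· | E] denotes expectation conditional on the event E. -/
open MeasureTheory ProbabilityTheory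

lemma censor_key
    {Ω : Type*} [MeasurableSpace Ω] (μ : Measure Ω) [IsProbabilityMeasure μ]
    {F : Type*} [MeasurableSpace F]
    (C : Ω → ℝ) (W : Ω → F) (hC : Measurable C) (hW : Measurable W)
    (hind : IndepFun C W μ)
    (G : ℝ → ℝ) (hG : ∀ t, G t = (μ {ω | t ≤ C ω}).toReal)
    (f h : F → ℝ) (hf : Measurable f) (hh : Measurable h)
    (hfi : Integrable (fun ω => f (W ω)) μ) :
    ∫ ω, (if h (W ω) ≤ C ω then f (W ω) else 0) ∂μ = ∫ ω, G (h (W ω)) * f (W ω) ∂μ := by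
  classical
  have hprod := (indepFun_iff_map_prod_eq_prod_map_map hW.aemeasurable hC.aemeasurable).1 hind.symm
  have hWC : Measurable (fun ω => (W ω, C ω)) := hW.prodMk hC
  have : IsProbabilityMeasure (μ.map W) := Measure.isProbabilityMeasure_map hW.aemeasurable
  have : IsProbabilityMeasure (μ.map C) := Measure.isProbabilityMeasure_map hC.aemeasurable
  have hGm : Measurable G := by
    apply Antitone.measurable
    intro a b hab
    rw [hG, hG]
    exact ENNReal.toReal_mono (measure_ne_top _ _)
      (measure_mono fun ω (hω : b ≤ C ω) => hab.trans hω)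
  let g : F × ℝ → ℝ := fun p => if h p.1 ≤ p.2 then f p.1 else 0
  have hg : Measurable g :=
    Measurable.ite (measurableSet_le (hh.comp measurable_fst) measurable_snd)
      (hf.comp measurable_fst) measurable_const
  have hgi : Integrable g ((μ.map W).prod (μ.map C)) := by
    rw [← hprod, integrable_map_measure hg.aestronglyMeasurable hWC.aemeasurable]
    refine hfi.mono (hg.comp hWC).aestronglyMeasurable (ae_of_all _ fun ω => ?_)
    simp only [Function.comp, g]
    split_ifs <;> simp
  calc ∫ ω, (if h (W ω) ≤ C ω then f (W ω) else 0) ∂μ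
      = ∫ p, g p ∂(μ.map (fun ω => (W ω, C ω))) :=
        (integral_map hWC.aemeasurable hg.aestronglyMeasurable).symm
    _ = ∫ w, ∫ c, g (w, c) ∂(μ.map C) ∂(μ.map W) := by
        rw [hprod, integral_prod _ hgi]
    _ = ∫ w, G (h w) * f w ∂(μ.map W) := by
        congr 1
        ext w
        have : (fun c => g (w, c)) = (Set.Ici (h w)).indicator (fun _ => f w) := by
          ext c
          simp [g, Set.indicator_apply]
        rw [this, integral_indicator_const _ measurableSet_Ici, hG, measureReal_def,
          Measure.map_apply hC measurableSet_Ici, smul_eq_mul]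
        rfl
    _ = _ := integral_map hW.aemeasurable ((hGm.comp hh).mul hf).aestronglyMeasurable

/-- For every `s ∈ ℝ` and every event `D ∈ σ(Z)`,
`E[T·1_D·1(X ≥ s)] = G(s)·E[Ỹ·1_D·1(X ≥ s)]`; consequently, whenever
`P(D ∩ {X ≥ s}) > 0` and `G(s) > 0`,
`E[T | D ∩ {X ≥ s}] = G(s)·E[Ỹ | D ∩ {X ≥ s}]`. -/
theorem synthetic_response_at_risk_identity
    {Ω : Type*} [MeasurableSpace Ω] (μ : Measure Ω) [IsProbabilityMeasure μ]
    {E : Type*} [mE : MeasurableSpace E]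
    (T C : Ω → ℝ) (Z : Ω → E)
    (hT : Measurable T) (hC : Measurable C) (hZ : Measurable Z)
    (hind : IndepFun C (fun ω => (T ω, Z ω)) μ)
    (G : ℝ → ℝ) (hG : ∀ t, G t = (μ {ω | t ≤ C ω}).toReal)
    (Ytil : Ω → ℝ)
    (hY : ∀ ω, Ytil ω = if T ω ≤ C ω then T ω / G (T ω) else 0)
    (hTint : Integrable T μ)
    (hGpos : ∀ᵐ ω ∂μ, 0 < G (T ω))
    (hint : Integrable (fun ω => |T ω| / G (T ω)) μ) :
    ∀ (s : ℝ) (D : Set Ω), MeasurableSet[MeasurableSpace.comap Z mE] D →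
      (∫ ω in D ∩ {ω | s ≤ min (T ω) (C ω)}, T ω ∂μ
          = G s * ∫ ω in D ∩ {ω | s ≤ min (T ω) (C ω)}, Ytil ω ∂μ)
      ∧ (0 < μ (D ∩ {ω | s ≤ min (T ω) (C ω)}) → 0 < G s →
          (∫ ω in D ∩ {ω | s ≤ min (T ω) (C ω)}, T ω ∂μ)
              / (μ (D ∩ {ω | s ≤ min (T ω) (C ω)})).toReal
            = G s * ((∫ ω in D ∩ {ω | s ≤ min (T ω) (C ω)}, Ytil ω ∂μ)
              / (μ (D ∩ {ω | s ≤ min (T ω) (C ω)})).toReal)) := by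
  classical
  intro s D hD
  have main : ∫ ω in D ∩ {ω | s ≤ min (T ω) (C ω)}, T ω ∂μ
          = G s * ∫ ω in D ∩ {ω | s ≤ min (T ω) (C ω)}, Ytil ω ∂μ := by
    obtain ⟨B, hB, rfl⟩ := hD
    have hGm : Measurable G := by
      apply Antitone.measurable
      intro a b hab
      rw [hG, hG]
      exact ENNReal.toReal_mono (measure_ne_top _ _)
        (measure_mono fun ω (hω : b ≤ C ω) => hab.trans hω)
    have hS : MeasurableSet (Z ⁻¹' B ∩ {ω | s ≤ min (T ω) (C ω)}) :=
      (hZ hB).inter (measurableSet_le measurable_const (hT.min hC))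
    let A : Set (ℝ × E) := {p | s ≤ p.1 ∧ p.2 ∈ B}
    have hA : MeasurableSet A :=
      (measurableSet_le measurable_const measurable_fst).inter (measurable_snd hB)
    have hW : Measurable (fun ω => (T ω, Z ω)) := hT.prodMk hZ
    let f₁ : ℝ × E → ℝ := A.indicator fun p => p.1
    let f₂ : ℝ × E → ℝ := A.indicator fun p => p.1 / G p.1
    have hf₁ : Measurable f₁ := measurable_fst.indicator hA
    have hf₂ : Measurable f₂ :=
      (measurable_fst.div (hGm.comp measurable_fst)).indicator hA
    have hi₁ : Integrable (fun ω => f₁ (T ω, Z ω)) μ := by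
      refine hTint.mono (hf₁.comp hW).aestronglyMeasurable (ae_of_all _ fun ω => ?_)
      exact norm_indicator_le_norm_self (fun p : ℝ × E => p.1) (T ω, Z ω)
    have hi₂ : Integrable (fun ω => f₂ (T ω, Z ω)) μ := by
      refine hint.mono (hf₂.comp hW).aestronglyMeasurable (ae_of_all _ fun ω => ?_)
      refine (norm_indicator_le_norm_self (fun p : ℝ × E => p.1 / G p.1) (T ω, Z ω)).trans ?_
      simp
    have k₁ := censor_key μ C _ hC hW hind G hG f₁ (fun _ => s) hf₁ measurable_const hi₁
    have k₂ := censor_key μ C _ hC hW hind G hG f₂ Prod.fst hf₂ measurable_fst hi₂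
    have e₁ : ∫ ω in Z ⁻¹' B ∩ {ω | s ≤ min (T ω) (C ω)}, T ω ∂μ
        = ∫ ω, (if s ≤ C ω then f₁ (T ω, Z ω) else 0) ∂μ := by
      rw [← integral_indicator hS]
      congr 1
      ext ω
      simp only [f₁, A, Set.indicator_apply, Set.mem_inter_iff, Set.mem_preimage,
        Set.mem_setOf_eq, le_min_iff]
      split_ifs <;> tauto
    have e₂ : ∫ ω in Z ⁻¹' B ∩ {ω | s ≤ min (T ω) (C ω)}, Ytil ω ∂μ
        = ∫ ω, (if T ω ≤ C ω then f₂ (T ω, Z ω) else 0) ∂μ := by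
      rw [← integral_indicator hS]
      congr 1
      ext ω
      simp only [f₂, A, Set.indicator_apply, Set.mem_inter_iff, Set.mem_preimage,
        Set.mem_setOf_eq, le_min_iff, hY]
      have : s ≤ T ω → T ω ≤ C ω → s ≤ C ω := le_trans
      split_ifs <;> tauto
    rw [e₁, e₂, k₁, k₂, integral_const_mul]
    congr 1
    apply integral_congr_ae
    filter_upwards [hGpos] with ω hω
    simp only [f₁, f₂, Set.indicator_apply]
    split_ifs
    · field_simp
    · simp
  refine ⟨main, fun _ _ => ?_⟩
  rw [main, mul_div_assoc]
end

section
/- For every function g : S → ℝ, E[ ( 1(A = 1) · P(A = 0 | B = B(ω)) / P(A = 1 | B = B(ω)) − 1(A = 0) ) · g(B(ω)) ] = 0. That is, the weighted exposure indicator 1(A=1)·odds(B) exactly balances the indicator 1(A=0) against any function of the mediator, where odds(u) = P(A=0 | B=u)/P(A=1 | B=u). -/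
open MeasureTheory ProbabilityTheory

/-- For every `g : S → ℝ`,
`E[(1(A=1)·P(A=0|B)/P(A=1|B) − 1(A=0))·g(B)] = 0`:
the weighted exposure indicator `1(A=1)·odds(B)` exactly balances `1(A=0)`
against any function of the mediator. -/
theorem weighted_exposure_balances_mediator
    {Ω : Type*} [MeasurableSpace Ω] (μ : Measure Ω) [IsProbabilityMeasure μ]
    (S : Finset ℝ) (hS : S.Nonempty)
    (A : Ω → Bool) (hA : Measurable A)
    (B : Ω → ℝ) (hB : Measurable B) (hBS : ∀ ω, B ω ∈ S)
    (hpos : ∀ (a : Bool), ∀ u ∈ S, 0 < μ ({ω | A ω = a} ∩ {ω | B ω = u})) :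
    ∀ g : ℝ → ℝ,
      ∫ ω, ((if A ω = true then (1 : ℝ) else 0)
              * (((μ ({ω' | A ω' = false} ∩ {ω' | B ω' = B ω})).toReal
                    / (μ {ω' | B ω' = B ω}).toReal)
                  / ((μ ({ω' | A ω' = true} ∩ {ω' | B ω' = B ω})).toReal
                    / (μ {ω' | B ω' = B ω}).toReal))
            - (if A ω = false then (1 : ℝ) else 0)) * g (B ω) ∂μ = 0 := by
  intro g
  set p : ℝ → ℝ := fun u => (μ {ω' | B ω' = u}).toReal with hp
  set q : Bool → ℝ → ℝ := fun a u => (μ ({ω' | A ω' = a} ∩ {ω' | B ω' = u})).toReal with hq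
  have hmeas : ∀ a u, MeasurableSet ({ω' | A ω' = a} ∩ {ω' | B ω' = u}) := fun a u =>
    (hA (measurableSet_singleton a)).inter (hB (measurableSet_singleton u))
  have key : ∀ ω, ((if A ω = true then (1 : ℝ) else 0)
        * ((q false (B ω) / p (B ω)) / (q true (B ω) / p (B ω)))
        - (if A ω = false then (1 : ℝ) else 0)) * g (B ω)
      = ∑ u ∈ S, (({ω' | A ω' = true} ∩ {ω' | B ω' = u}).indicator
            (fun _ => ((q false u / p u) / (q true u / p u)) * g u) ω
          - ({ω' | A ω' = false} ∩ {ω' | B ω' = u}).indicator (fun _ => g u) ω) := by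
    intro ω
    rw [Finset.sum_eq_single (B ω)]
    · cases h : A ω <;> simp [Set.indicator, h]
    · intro u _ hu
      simp [Set.indicator, hu.symm]
    · intro h
      exact absurd (hBS ω) h
  have hint : ∀ a u (c : ℝ), Integrable
      (({ω' | A ω' = a} ∩ {ω' | B ω' = u}).indicator (fun _ => c)) μ := fun a u c =>
    (integrable_const c).indicator (hmeas a u)
  change ∫ ω, ((if A ω = true then (1 : ℝ) else 0)
        * ((q false (B ω) / p (B ω)) / (q true (B ω) / p (B ω)))
        - (if A ω = false then (1 : ℝ) else 0)) * g (B ω) ∂μ = 0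
  rw [integral_congr_ae (Filter.Eventually.of_forall key), integral_finsetSum]
  swap
  · intro u _
    exact (hint _ _ _).sub (hint _ _ _)
  refine Finset.sum_eq_zero fun u hu => ?_
  rw [integral_sub (hint _ _ _) (hint _ _ _), integral_indicator_const _ (hmeas _ _),
    integral_indicator_const _ (hmeas _ _)]
  have h1 : 0 < q true u := ENNReal.toReal_pos (hpos true u hu).ne' (measure_ne_top _ _)
  have h2 : 0 < p u := ENNReal.toReal_pos
    ((hpos true u hu).trans_le (measure_mono Set.inter_subset_right)).ne' (measure_ne_top _ _)
  change q true u * _ - q false u * _ = 0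
  field_simp
  ring
end
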